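/- Let $F_2$ be the free group on generators $a_1, a_2$. Let $B_1 \in F_2$ be represented by a reduced word of the form $a_1^{\epsilon_1 2} a_2^{\epsilon_2 2} \cdots a_1^{\epsilon_{2m-1} 2} a_2^{\epsilon_{2m} 2}$ with each $\epsilon_i \in \{1,-1\}$ and $2m \geq 4$ terms. Let $B_2 \in F_2$ be represented by a reduced word with at least 4 terms such that in every block of 4 consecutive terms at least two terms have exponent $+1$ or $-1$. Then $B_1$ and $B_2$ are not conjugate in $F_2$. -/

import Mathlib

/-- The element of the free group on two generators represented by a word
given as a list of terms `(generator index, exponent)`. -/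
def wordEval (w : List (Fin 2 × ℤ)) : FreeGroup (Fin 2) :=
  (w.map fun p => FreeGroup.of p.1 ^ p.2).prod

/-- A list of terms is a reduced word: all exponents are nonzero and
consecutive terms are powers of different generators. -/
def IsReducedWord (w : List (Fin 2 × ℤ)) : Prop :=
  (∀ p ∈ w, p.2 ≠ 0) ∧ w.Chain' fun p q => p.1 ≠ q.1

theorem isReducedWord_iff {w : List (Fin 2 × ℤ)} :
    IsReducedWord w ↔ (∀ p ∈ w, p.2 ≠ 0) ∧ (w.map Prod.fst).IsChain (· ≠ ·) := by
  rw [List.isChain_map]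
  rfl

@[simp]
theorem wordEval_nil : wordEval [] = 1 := rfl

@[simp]
theorem wordEval_cons (p : Fin 2 × ℤ) (w : List (Fin 2 × ℤ)) :
    wordEval (p :: w) = FreeGroup.of p.1 ^ p.2 * wordEval w := by
  simp [wordEval]

@[simp]
theorem wordEval_append (v w : List (Fin 2 × ℤ)) :
    wordEval (v ++ w) = wordEval v * wordEval w := by
  simp [wordEval]

/-- The word representing the inverse of the element represented by `w`. -/
def invWord (w : List (Fin 2 × ℤ)) : List (Fin 2 × ℤ) :=
  (w.map fun p => (p.1, -p.2)).reverse

theorem wordEval_invWord (w : List (Fin 2 × ℤ)) : wordEval (invWord w) = (wordEval w)⁻¹ := by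
  induction w with
  | nil => simp [invWord]
  | cons p w ih =>
    simp only [invWord, List.map_cons, List.reverse_cons, wordEval_append] at ih ⊢
    simp [ih]

theorem map_fst_invWord (w : List (Fin 2 × ℤ)) :
    (invWord w).map Prod.fst = (w.map Prod.fst).reverse := by
  simp [invWord, List.map_reverse, Function.comp_def]

theorem snd_ne_zero_of_mem_invWord {w : List (Fin 2 × ℤ)} (h : ∀ p ∈ w, p.2 ≠ 0) :
    ∀ p ∈ invWord w, p.2 ≠ 0 := by
  intro p hp
  simp only [invWord, List.mem_reverse, List.mem_map] at hp
  obtain ⟨q, hq, rfl⟩ := hp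
  simpa using h q hq

/-- Every word represents the same element as some reduced word. -/
theorem exists_isReducedWord_wordEval_eq (w : List (Fin 2 × ℤ)) :
    ∃ w', IsReducedWord w' ∧ wordEval w' = wordEval w := by
  induction w with
  | nil => exact ⟨[], by simp [isReducedWord_iff], rfl⟩
  | cons p w ih =>
    obtain ⟨v, hv, hvw⟩ := ih
    obtain ⟨a, k⟩ := p
    rw [isReducedWord_iff] at hv
    by_cases hk : k = 0
    · exact ⟨v, isReducedWord_iff.2 hv, by simp [hvw, hk]⟩
    rcases v with _ | ⟨⟨b, l⟩, v⟩
    · exact ⟨[(a, k)], by simp [isReducedWord_iff, hk], by simp [← hvw]⟩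
    by_cases hab : a = b
    · subst hab
      by_cases hkl : k + l = 0
      · refine ⟨v, isReducedWord_iff.2 ⟨fun p hp => hv.1 p (by simp [hp]), hv.2.tail⟩, ?_⟩
        rw [wordEval_cons, ← hvw, wordEval_cons, ← mul_assoc, ← zpow_add, hkl]
        simp
      · refine ⟨(a, k + l) :: v, isReducedWord_iff.2 ⟨?_, by simpa using hv.2⟩, ?_⟩
        · intro p hp
          rcases List.mem_cons.1 hp with rfl | hp
          · exact hkl
          · exact hv.1 p (by simp [hp])
        · rw [wordEval_cons, wordEval_cons, ← hvw, wordEval_cons, ← mul_assoc, ← zpow_add]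
    · refine ⟨(a, k) :: (b, l) :: v, isReducedWord_iff.2 ⟨?_, ?_⟩, by rw [wordEval_cons, hvw,
        wordEval_cons]⟩
      · intro p hp
        rcases List.mem_cons.1 hp with rfl | hp
        · exact hk
        · exact hv.1 p hp
      · simp only [List.map_cons, List.isChain_cons_cons] at hv ⊢
        exact ⟨hab, hv.2⟩

theorem exists_isReducedWord (g : FreeGroup (Fin 2)) :
    ∃ w, IsReducedWord w ∧ wordEval w = g := by
  suffices h : ∃ w, wordEval w = g by
    obtain ⟨w, rfl⟩ := h
    exact exists_isReducedWord_wordEval_eq w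
  induction g using FreeGroup.induction_on with
  | C1 => exact ⟨[], rfl⟩
  | of a => exact ⟨[(a, 1)], by simp⟩
  | inv_of a _ => exact ⟨[(a, -1)], by simp⟩
  | mul x y hx hy =>
    obtain ⟨v, rfl⟩ := hx
    obtain ⟨w, rfl⟩ := hy
    exact ⟨v ++ w, wordEval_append v w⟩

/-- Distinct reduced words represent distinct elements. -/
theorem IsReducedWord.eq_of_wordEval_eq {v w : List (Fin 2 × ℤ)} (hv : IsReducedWord v)
    (hw : IsReducedWord w) (h : wordEval v = wordEval w) : v = w := by
  let M : Fin 2 → Type := fun _ => Multiplicative ℤ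
  let f : Fin 2 × ℤ → Σ i, M i := fun p => ⟨p.1, Multiplicative.ofAdd p.2⟩
  have hf : Function.Injective f := by
    rintro ⟨a, k⟩ ⟨b, l⟩ hkl
    simp only [f, Sigma.mk.injEq] at hkl
    obtain ⟨rfl, hkl⟩ := hkl
    simpa using hkl
  let word : ∀ u, IsReducedWord u → Monoid.CoprodI.Word M := fun u hu =>
    { toList := u.map f
      ne_one := by
        intro q hq
        obtain ⟨p, hp, rfl⟩ := List.mem_map.1 hq
        exact fun h => hu.1 p hp (ofAdd_eq_one.1 h)
      chain_ne := (List.isChain_map f).2 hu.2 }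
  let φ : FreeGroup (Fin 2) →* Monoid.CoprodI M :=
    FreeGroup.lift fun i => Monoid.CoprodI.of (M := M) (i := i) (Multiplicative.ofAdd (1 : ℤ))
  have hφ : ∀ u (hu : IsReducedWord u), φ (wordEval u) = (word u hu).prod := by
    intro u hu
    simp only [wordEval, Monoid.CoprodI.Word.prod, word, map_list_prod, List.map_map]
    congr 1
    refine List.map_congr_left fun p _ => ?_
    simp only [Function.comp_apply, map_zpow, φ, FreeGroup.lift_apply_of, f]
    rw [← map_zpow, ← ofAdd_zsmul]
    simp
  have hprod : (word v hv).prod = (word w hw).prod := by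
    rw [← hφ v hv, ← hφ w hw, h]
  have hword : word v hv = word w hw := by
    classical
    exact Monoid.CoprodI.Word.equiv.symm.injective hprod
  exact hf.list_map (congrArg Monoid.CoprodI.Word.toList hword)

/-- A word has three consecutive terms with exponent `2` or `-2`. -/
def HasTripleSquare (w : List (Fin 2 × ℤ)) : Prop :=
  ∃ p t q, w = p ++ t ++ q ∧ t.length = 3 ∧ ∀ x ∈ t, x.2 = 2 ∨ x.2 = -2

theorem HasTripleSquare.of_append {p u q : List (Fin 2 × ℤ)} (hlen : 3 ≤ u.length)
    (hu : ∀ x ∈ u, x.2 = 2 ∨ x.2 = -2) : HasTripleSquare (p ++ u ++ q) :=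
  ⟨p, u.take 3, u.drop 3 ++ q, by
    rw [← List.append_assoc, List.append_assoc p (u.take 3), List.take_append_drop],
    by simpa using hlen, fun x hx => hu x (List.mem_of_mem_take hx)⟩

theorem IsReducedWord.conj {g u : List (Fin 2 × ℤ)} {a : Fin 2} {k k' l : ℤ}
    (hg : IsReducedWord (g ++ [(a, k)])) (hu : ∀ p ∈ u, p.2 ≠ 0)
    (hchain : ([a] ++ u.map Prod.fst ++ [a]).IsChain (· ≠ ·)) (hk' : k' ≠ 0) (hl : l ≠ 0) :
    IsReducedWord ((g ++ [(a, k')]) ++ u ++ ([(a, l)] ++ invWord g)) := by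
  rw [isReducedWord_iff] at hg ⊢
  constructor
  · have hg' : ∀ p ∈ g, p.2 ≠ 0 := fun p hp => hg.1 p (by simp [hp])
    intro p hp
    simp only [List.mem_append, List.mem_singleton] at hp
    rcases hp with ((hp | rfl) | hp) | rfl | hp
    exacts [hg' p hp, hk', hu p hp, hl, snd_ne_zero_of_mem_invWord hg' p hp]
  · have h₁ : (g.map Prod.fst ++ [a]).IsChain (· ≠ ·) := by simpa using hg.2
    have h₂ : ([a] ++ (g.map Prod.fst).reverse).IsChain (· ≠ ·) := by
      have := List.isChain_reverse.2 (h₁.imp fun _ _ => Ne.symm)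
      simpa using this
    have h₃ := hchain.append_overlap h₂ (by simp)
    have h₄ := h₁.append_overlap (l₃ := u.map Prod.fst ++ [a] ++ (g.map Prod.fst).reverse)
      (by simpa using h₃) (by simp)
    simpa [map_fst_invWord] using h₄

/-- Conjugates of a cyclically reduced word with all exponents `2` or `-2` and at least four terms
are represented by reduced words with three consecutive such exponents. -/
theorem exists_conj_hasTripleSquare (g : List (Fin 2 × ℤ)) (hg : IsReducedWord g) (a : Fin 2)
    (e : ℤ) (u : List (Fin 2 × ℤ)) (hlen : 3 ≤ u.length) (he : e = 2 ∨ e = -2)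
    (hu : ∀ p ∈ u, p.2 = 2 ∨ p.2 = -2)
    (hchain : ([a] ++ u.map Prod.fst ++ [a]).IsChain (· ≠ ·)) :
    ∃ w, IsReducedWord w ∧ HasTripleSquare w ∧
      wordEval w = wordEval g * wordEval ((a, e) :: u) * (wordEval g)⁻¹ := by
  have hne : ∀ {p : Fin 2 × ℤ}, (p.2 = 2 ∨ p.2 = -2) → p.2 ≠ 0 := by
    intro p hp
    omega
  induction g using List.reverseRecOn generalizing a e u with
  | nil =>
    refine ⟨(a, e) :: u, isReducedWord_iff.2 ⟨?_, ?_⟩, ?_, by simp⟩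
    · intro p hp
      rcases List.mem_cons.1 hp with rfl | hp
      exacts [hne he, hne (hu p hp)]
    · simpa using hchain.left_of_append
    · simpa using HasTripleSquare.of_append (p := [(a, e)]) (q := []) hlen hu
  | append_singleton g t ih =>
    obtain ⟨b, k⟩ := t
    have hk : k ≠ 0 := hg.1 (b, k) (by simp)
    have hg' : IsReducedWord g := by
      rw [isReducedWord_iff] at hg ⊢
      exact ⟨fun p hp => hg.1 p (by simp [hp]), by
        have := hg.2
        rw [List.map_append] at this
        exact this.left_of_append⟩
    by_cases hab : a = b
    · subst hab
      by_cases hke : k + e = 0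
      · obtain ⟨⟨c, f⟩, v, rfl⟩ : ∃ x v, u = x :: v := by
          cases u with
          | nil => simp at hlen
          | cons x v => exact ⟨x, v, rfl⟩
        obtain ⟨w, hw, hw', hwe⟩ := ih hg' c f (v ++ [(a, e)]) (by simpa using hlen)
          (hu (c, f) (by simp))
          (by
            intro p hp
            rcases List.mem_append.1 hp with hp | hp
            · exact hu p (by simp [hp])
            · rw [List.mem_singleton.1 hp]
              exact he)
          (by
            have h₁ : ([c] ++ v.map Prod.fst ++ [a]).IsChain (· ≠ ·) := by
              simpa using hchain.tail
            have h₂ : a ≠ c := by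
              simp only [List.map_cons, List.cons_append, List.nil_append,
                List.isChain_cons_cons] at hchain
              exact hchain.1
            have := h₁.append_overlap (l₃ := [c]) (by simpa using h₂) (by simp)
            simpa using this)
        refine ⟨w, hw, hw', ?_⟩
        obtain rfl : k = -e := by omega
        rw [hwe]
        simp [mul_assoc]
      · refine ⟨_, hg.conj (fun p hp => hne (hu p hp)) hchain hke (neg_ne_zero.2 hk),
          HasTripleSquare.of_append hlen hu, ?_⟩
        simp [wordEval_invWord, mul_assoc, zpow_add]
    · obtain ⟨v, ⟨c, f⟩, rfl⟩ : ∃ v x, u = v ++ [x] := by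
        have hu0 : u ≠ [] := by
          rintro rfl
          simp at hlen
        exact ⟨u.dropLast, u.getLast hu0, (List.dropLast_append_getLast hu0).symm⟩
      have hca : c ≠ a := by
        refine (List.isChain_append.1 hchain).2.2 c ?_ a (by simp)
        rw [List.map_append, ← List.append_assoc]
        exact List.getLast?_concat
      obtain rfl : c = b := by omega
      have hf : f = 2 ∨ f = -2 := hu (c, f) (by simp)
      have hu' : ∀ p ∈ (a, e) :: v, p.2 = 2 ∨ p.2 = -2 := by
        intro p hp
        rcases List.mem_cons.1 hp with rfl | hp
        exacts [he, hu p (by simp [hp])]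
      have hlen' : 3 ≤ ((a, e) :: v).length := by simpa using hlen
      have hchain' : ([c] ++ ((a, e) :: v).map Prod.fst ++ [c]).IsChain (· ≠ ·) := by
        have h₁ := hchain.left_of_append
        simp only [List.map_append, List.map_cons, List.map_nil, List.cons_append,
          List.nil_append, List.isChain_cons_cons] at h₁ ⊢
        exact ⟨hca, h₁⟩
      by_cases hkf : f - k = 0
      · obtain ⟨w, hw, hw', hwe⟩ := ih hg' c f ((a, e) :: v) hlen' hf hu' hchain'
        refine ⟨w, hw, hw', ?_⟩
        obtain rfl : k = f := by omega
        rw [hwe]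
        simp [mul_assoc]
      · refine ⟨_, hg.conj (fun p hp => hne (hu' p hp)) hchain' hk hkf,
          HasTripleSquare.of_append hlen' hu', ?_⟩
        simp [wordEval_invWord, mul_assoc, zpow_sub]

theorem HasTripleSquare.exists_countP_lt {w : List (Fin 2 × ℤ)} (hw : HasTripleSquare w)
    (hlen : 4 ≤ w.length) :
    ∃ i, i + 4 ≤ w.length ∧
      ((w.drop i).take 4).countP (fun p => p.2 = 1 ∨ p.2 = -1) < 2 := by
  obtain ⟨p, t, q, rfl, ht, htw⟩ := hw
  have hcount : t.countP (fun p => p.2 = 1 ∨ p.2 = -1) = 0 := by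
    rw [List.countP_eq_zero]
    intro x hx
    have := htw x hx
    simp only [decide_eq_true_eq]
    omega
  rcases q with _ | ⟨y, q⟩
  · obtain ⟨p, y, rfl⟩ : ∃ p' y, p = p' ++ [y] := by
      have hp : p ≠ [] := by
        rintro rfl
        simp [ht] at hlen
      exact ⟨p.dropLast, p.getLast hp, (List.dropLast_append_getLast hp).symm⟩
    refine ⟨p.length, by simp [ht], ?_⟩
    have : ((p ++ [y] ++ t ++ []).drop p.length).take 4 = [y] ++ t := by
      simp [List.take_of_length_le, ht]
    rw [this, List.countP_append, hcount]
    exact Nat.lt_succ_of_le List.countP_le_length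
  · refine ⟨p.length, by simp [ht]; omega, ?_⟩
    have : ((p ++ t ++ y :: q).drop p.length).take 4 = t ++ [y] := by
      simp [List.take_append, ht, List.take_of_length_le]
    rw [this, List.countP_append, hcount, zero_add]
    exact Nat.lt_succ_of_le List.countP_le_length

theorem stmt_14 (m : ℕ) (hm : 2 ≤ m) (w₁ w₂ : List (Fin 2 × ℤ))
    (hw₁len : w₁.length = 2 * m)
    (hw₁ : ∀ (i : ℕ) (hi : i < w₁.length),
      (w₁.get ⟨i, hi⟩).1 = (if i % 2 = 0 then 0 else 1) ∧
      ((w₁.get ⟨i, hi⟩).2 = 2 ∨ (w₁.get ⟨i, hi⟩).2 = -2))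
    (hw₂red : IsReducedWord w₂) (hw₂len : 4 ≤ w₂.length)
    (hw₂ : ∀ i : ℕ, i + 4 ≤ w₂.length →
      2 ≤ ((w₂.drop i).take 4).countP fun p => p.2 = 1 ∨ p.2 = -1) :
    ¬ IsConj (wordEval w₁) (wordEval w₂) := by
  intro hconj
  obtain ⟨c, hc⟩ := isConj_iff.1 hconj
  obtain ⟨g, hg, rfl⟩ := exists_isReducedWord c
  have hexp : ∀ p ∈ w₁, p.2 = 2 ∨ p.2 = -2 := by
    intro p hp
    obtain ⟨i, hi, rfl⟩ := List.getElem_of_mem hp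
    exact (hw₁ i hi).2
  have hcyc : (w₁.map Prod.fst ++ [0]).IsChain (· ≠ ·) := by
    rw [List.isChain_iff_getElem]
    intro i hi
    simp only [List.length_append, List.length_map, List.length_singleton] at hi
    have hi₁ : i < w₁.length := by omega
    have h₁ := (hw₁ i hi₁).1
    simp only [List.get_eq_getElem] at h₁
    by_cases hi₂ : i + 1 < w₁.length
    · have h₂ := (hw₁ (i + 1) hi₂).1
      simp only [List.get_eq_getElem] at h₂
      simp only [List.getElem_append, List.length_map, hi₁, hi₂, dif_pos, List.getElem_map, h₁, h₂]
      rcases Nat.mod_two_eq_zero_or_one i with h | h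
      · simp [h, Nat.add_mod]
      · simp [h, Nat.add_mod]
    · have hodd : i % 2 = 1 := by omega
      simp [List.getElem_append, hi₁, hi₂, h₁, hodd]
  obtain ⟨⟨a, e⟩, u, rfl⟩ : ∃ x u, w₁ = x :: u := by
    cases w₁ with
    | nil => simp at hw₁len; omega
    | cons x u => exact ⟨x, u, rfl⟩
  obtain rfl : a = 0 := by simpa using (hw₁ 0 (by simp)).1
  simp only [List.length_cons] at hw₁len
  obtain ⟨w, hw, hw', hwe⟩ := exists_conj_hasTripleSquare g hg 0 e u (by omega)
    (hexp (0, e) (by simp)) (fun p hp => hexp p (by simp [hp])) (by simpa using hcyc)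
  obtain rfl : w = w₂ := hw.eq_of_wordEval_eq hw₂red (hwe.trans hc)
  obtain ⟨i, hi, hlt⟩ := hw'.exists_countP_lt hw₂len
  exact absurd (hw₂ i hi) (not_le.2 hlt)
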